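/- (MacMahon's box formula in Schur function form) For positive integers a, b, c, Σ_{μ : ℓ(μ) ≤ c} s_{μ'}(1^a) s_{μ'}(1^b) = Π_{i=1}^a Π_{j=1}^b Π_{k=1}^c (i + j + k − 1)/(i + j + k − 2), where the sum is over partitions μ with at most c parts and μ' is the conjugate of μ. -/

import Mathlib

/-- The `k`-th elementary symmetric polynomial of `a : Fin M → ℝ`, extended by `0`
for `k < 0`. -/
noncomputable def esymmInt {M : ℕ} (a : Fin M → ℝ) (k : ℤ) : ℝ :=
  if 0 ≤ k then ∑ s ∈ Finset.univ.powersetCard k.toNat, ∏ i ∈ s, a i else 0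

/-- The Schur polynomial `s_μ(a)` in `M` variables, via the (dual) Jacobi–Trudi
determinant. -/
noncomputable def schur {M : ℕ} (a : Fin M → ℝ) (μ : YoungDiagram) : ℝ :=
  Matrix.det fun i j : Fin (μ.rowLen 0) =>
    esymmInt a ((μ.colLen i : ℤ) - (i : ℤ) + (j : ℤ))

namespace Matrix

/-- The **Cauchy–Binet formula**. -/
theorem det_mul_eq_sum_orderEmbedding {R : Type*} [CommRing R] {c n : ℕ}
    (A : Matrix (Fin c) (Fin n) R) (B : Matrix (Fin n) (Fin c) R) :
    (A * B).det =
      ∑ s : Fin c ↪o Fin n, (A.submatrix id s).det * (B.submatrix s id).det := by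
  have expand : (A * B).det =
      ∑ p : Fin c → Fin n, (A.submatrix id p).det * ∏ i, B (p i) i := by
    simp only [det_apply', mul_apply, Finset.prod_univ_sum, Fintype.piFinset_univ,
      Finset.mul_sum, Finset.sum_mul, submatrix_apply, id]
    rw [Finset.sum_comm]
    simp only [Finset.prod_mul_distrib, mul_assoc]
  have collect (s : Fin c ↪o Fin n) :
      (A.submatrix id s).det * (B.submatrix s id).det =
        ∑ τ : Equiv.Perm (Fin c),
          (A.submatrix id (s ∘ τ)).det * ∏ i, B ((s ∘ τ) i) i := by
    rw [det_apply' (B.submatrix s id), Finset.mul_sum]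
    refine Finset.sum_congr rfl fun τ _ => ?_
    have := det_permute' τ (A.submatrix id s)
    rw [submatrix_submatrix] at this
    simp only [Function.id_comp] at this
    rw [this]
    simp only [submatrix_apply, id, Function.comp_apply]
    ring
  rw [expand]
  simp only [collect]
  rw [← Fintype.sum_prod_type']
  symm
  refine Finset.sum_of_injOn
    (fun x : (Fin c ↪o Fin n) × Equiv.Perm (Fin c) => (x.1 : Fin c → Fin n) ∘ x.2)
    ?_ (fun _ _ => by simp) ?_ (fun _ _ => rfl)
  · rintro ⟨s, τ⟩ - ⟨s', τ'⟩ - h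
    simp only at h
    have hs : s = s' := by
      have : Set.range s = Set.range s' := by
        rw [← τ.surjective.range_comp s, ← τ'.surjective.range_comp s', h]
      exact OrderEmbedding.range_inj.mp this
    subst hs
    congr 1
    ext i : 1
    exact s.injective (congrFun h i)
  · intro p _ hp
    have hnot : ¬ Function.Injective p := by
      intro hinj
      refine hp ⟨(OrderEmbedding.ofStrictMono (p ∘ Tuple.sort p)
        ((Tuple.monotone_sort p).strictMono_of_injective
          (hinj.comp (Tuple.sort p).injective)), (Tuple.sort p)⁻¹), by simp, ?_⟩
      ext i
      simp
    rw [Function.not_injective_iff] at hnot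
    obtain ⟨i, j, hij, hne⟩ := hnot
    rw [det_zero_of_column_eq hne (by simp [hij]), zero_mul]

end Matrix

/-- The binomial coefficient `n.choose k` as a real number, extended by `0` to `k < 0`. -/
noncomputable def intChoose (n : ℕ) (k : ℤ) : ℝ :=
  if 0 ≤ k then (n.choose k.toNat : ℝ) else 0

namespace intChoose

theorem of_neg {n : ℕ} {k : ℤ} (hk : k < 0) : intChoose n k = 0 := by
  simp [intChoose, hk]

@[simp]
theorem natCast (n k : ℕ) : intChoose n (k : ℤ) = n.choose k := by
  simp [intChoose]

theorem of_lt {n : ℕ} {k : ℤ} (hk : (n : ℤ) < k) : intChoose n k = 0 := by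
  lift k to ℕ using by omega
  rw [natCast, Nat.choose_eq_zero_of_lt (by omega), Nat.cast_zero]

theorem symm (n : ℕ) (k : ℤ) : intChoose n (n - k) = intChoose n k := by
  rcases lt_or_ge k 0 with hk | hk
  · rw [of_neg hk, of_lt (by omega)]
  lift k to ℕ using hk
  rcases lt_or_ge n k with hn | hn
  · rw [of_neg (by omega), of_lt (by omega)]
  · rw [← Nat.cast_sub hn, natCast, natCast, Nat.choose_symm hn]

/-- The Chu–Vandermonde identity. -/
theorem sum_mul (m n : ℕ) (x : ℤ) {N : ℕ} (hN : m < N) :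
    ∑ p ∈ Finset.range N, intChoose m p * intChoose n (x - p) = intChoose (m + n) x := by
  rcases lt_or_ge x 0 with hx | hx
  · rw [of_neg hx]
    exact Finset.sum_eq_zero fun p _ => by rw [of_neg (k := x - p) (by omega), mul_zero]
  lift x to ℕ using hx
  rw [natCast, Nat.add_choose_eq, Finset.Nat.sum_antidiagonal_eq_sum_range_succ_mk]
  push_cast
  have h₁ : ∑ p ∈ Finset.range N, intChoose m p * intChoose n (x - p) =
      ∑ p ∈ Finset.range (N + x + 1), intChoose m p * intChoose n (x - p) := by
    refine Finset.sum_subset (by simp; omega) fun p _ hp => ?_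
    rw [of_lt (by simp at hp; omega), zero_mul]
  have h₂ : ∑ p ∈ Finset.range (x + 1), intChoose m p * intChoose n (x - p) =
      ∑ p ∈ Finset.range (N + x + 1), intChoose m p * intChoose n (x - p) := by
    refine Finset.sum_subset (by simp) fun p _ hp => ?_
    rw [of_neg (k := x - p) (by simp at hp; omega), mul_zero]
  rw [h₁, ← h₂]
  refine Finset.sum_congr rfl fun p hp => ?_
  rw [← Nat.cast_sub (by simp at hp; omega), natCast, natCast]

theorem sum_shift_mul (m n j : ℕ) (x : ℤ) {N : ℕ} (hN : m + j < N) :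
    ∑ p ∈ Finset.range N, intChoose m (p - j) * intChoose n (x - p) =
      intChoose (m + n) (x - j) := by
  obtain ⟨M, rfl⟩ : ∃ M, N = j + M := ⟨N - j, by omega⟩
  rw [Finset.sum_range_add, Finset.sum_eq_zero, zero_add, ← sum_mul m n (x - j) (N := M) (by omega)]
  · refine Finset.sum_congr rfl fun p _ => ?_
    congr 2 <;> push_cast <;> ring
  · intro p hp
    rw [of_neg (by simp at hp; omega), zero_mul]

end intChoose

theorem esymmInt_one (M : ℕ) (k : ℤ) : esymmInt (fun _ : Fin M => (1 : ℝ)) k = intChoose M k := by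
  simp [esymmInt, intChoose]

theorem det_intChoose (a b c : ℕ) :
    (Matrix.of fun i j : Fin c => intChoose (a + b) ((b : ℤ) + i - j)).det =
      ∏ k ∈ Finset.range c,
        (((a + b + k).factorial * k.factorial : ℝ) / ((a + k).factorial * (b + k).factorial)) := by
  rcases c with _ | c
  · simp
  let U : Matrix (Fin (c + 1)) (Fin (c + 1)) ℝ :=
    .of fun j k => intChoose (c - k) ((j : ℤ) - k)
  have hU : U.det = 1 := by
    rw [Matrix.det_of_isLowerTriangular]
    · refine Finset.prod_eq_one fun i _ => ?_
      have := intChoose.natCast (c - i) 0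
      simpa [U] using this
    · intro i j hij
      have : i < j := hij
      exact intChoose.of_neg (by omega)
  rw [← mul_one (Matrix.det _), ← hU, ← Matrix.det_mul]
  have hmul : (Matrix.of fun i j : Fin (c + 1) => intChoose (a + b) ((b : ℤ) + i - j)) * U =
      .of fun i k => (((a + b + (c - k)).factorial : ℝ)) * (Matrix.of fun i k : Fin (c + 1) =>
        (((a + (c - i)).factorial * (b + i).factorial : ℝ)⁻¹) *
          (Matrix.of fun i k : Fin (c + 1) => (descPochhammer ℝ k).eval ((i : ℝ) + b)) i k) i k := by
    ext i k
    have hk : (k : ℕ) ≤ c := by omega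
    have hi : (i : ℕ) ≤ c := by omega
    simp only [Matrix.mul_apply, Matrix.of_apply, U]
    rw [Fin.sum_univ_eq_sum_range
      (fun j => intChoose (a + b) ((b : ℤ) + i - j) * intChoose (c - k) ((j : ℤ) - k)) (c + 1)]
    simp only [mul_comm (intChoose (a + b) _)]
    rw [intChoose.sum_shift_mul (c - k) (a + b) k _ (by omega)]
    have e : (i : ℝ) + b = ((b + i : ℕ) : ℝ) := by push_cast; ring
    rw [e, descPochhammer_eval_eq_descFactorial]
    rcases lt_or_ge (b + i : ℕ) k with h | h
    · rw [intChoose.of_neg (by omega), Nat.descFactorial_of_lt h]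
      simp
    · have e₂ : (b : ℤ) + i - k = ((b + i - k : ℕ) : ℤ) := by omega
      rw [e₂, intChoose.natCast, Nat.choose_eq_factorial_div_factorial (by omega),
        Nat.cast_div (Nat.factorial_mul_factorial_dvd_factorial (by omega)) (by positivity)]
      rw [← Nat.factorial_mul_descFactorial h]
      have e₃ : c - k + (a + b) - (b + i - k) = a + (c - i) := by omega
      have e₄ : c - k + (a + b) = a + b + (c - k) := by omega
      rw [e₃, e₄]
      push_cast
      have h₁ : ((b + i - k : ℕ).factorial : ℝ) ≠ 0 := by positivity
      have h₂ : ((a + (c - i) : ℕ).factorial : ℝ) ≠ 0 := by positivity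
      by_cases h₃ : ((b + i : ℕ).descFactorial k : ℝ) = 0
      · rw [Nat.cast_eq_zero, Nat.descFactorial_eq_zero_iff_lt] at h₃
        omega
      · field_simp
  rw [hmul, Matrix.det_mul_row, Matrix.det_mul_column,
    ← Matrix.det_eval_matrixOfPolynomials_eq_det_vandermonde (fun i : Fin (c + 1) => (i : ℝ) + b)
      (fun k => descPochhammer ℝ k) (fun k => descPochhammer_natDegree ℝ k)
      (fun k => monic_descPochhammer ℝ k),
    Matrix.det_vandermonde_add, Matrix.det_vandermonde_id_eq_superFactorial,
    ← Nat.prod_range_succ_factorial,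
    Fin.prod_univ_eq_prod_range (fun k => ((a + b + (c - k)).factorial : ℝ)),
    Fin.prod_univ_eq_prod_range
      (fun i => ((a + (c - i)).factorial * (b + i).factorial : ℝ)⁻¹),
    Finset.prod_inv_distrib, Finset.prod_mul_distrib, Finset.prod_div_distrib,
    Finset.prod_mul_distrib, Finset.prod_mul_distrib,
    ← Finset.prod_range_reflect (fun k => ((a + b + k).factorial : ℝ)),
    ← Finset.prod_range_reflect (fun k => ((a + k).factorial : ℝ))]
  simp only [Nat.add_sub_cancel]
  push_cast
  rw [div_eq_mul_inv]
  ring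

theorem prod_box_ratio (a b c : ℕ) :
    ∏ i ∈ Finset.Icc 1 a, ∏ j ∈ Finset.Icc 1 b, ∏ k ∈ Finset.Icc 1 c,
        (((i : ℝ) + j + k - 1) / ((i : ℝ) + j + k - 2)) =
      ∏ k ∈ Finset.range c,
        (((a + b + k).factorial * k.factorial : ℝ) / ((a + k).factorial * (b + k).factorial)) := by
  have row (i k : ℕ) : ∏ j ∈ Finset.range b, (((i : ℝ) + j + k + 2) / ((i : ℝ) + j + k + 1)) =
      ((i : ℝ) + b + k + 1) / ((i : ℝ) + k + 1) := by
    induction b with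
    | zero => simp; rw [div_self (by positivity)]
    | succ b ih =>
      rw [Finset.prod_range_succ, ih]
      push_cast
      field_simp
      ring
  have slab (k : ℕ) : ∏ i ∈ Finset.range a, (((i : ℝ) + b + k + 1) / ((i : ℝ) + k + 1)) =
      ((a + b + k).factorial * k.factorial : ℝ) / ((a + k).factorial * (b + k).factorial) := by
    induction a with
    | zero =>
      rw [Finset.prod_range_zero, eq_comm, div_eq_one_iff_eq (by positivity)]
      simp only [zero_add]
      ring
    | succ a ih =>
      rw [Finset.prod_range_succ, ih]
      have e₁ : a + 1 + b + k = (a + b + k) + 1 := by ring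
      have e₂ : a + 1 + k = (a + k) + 1 := by ring
      rw [e₁, e₂, Nat.factorial_succ, Nat.factorial_succ]
      push_cast
      field_simp
  have shift (n : ℕ) (f : ℕ → ℝ) :
      ∏ i ∈ Finset.Icc 1 n, f i = ∏ i ∈ Finset.range n, f (i + 1) := by
    rw [Finset.range_eq_Ico, Finset.prod_Ico_add' f 0 n 1, zero_add,
      Finset.Ico_add_one_right_eq_Icc]
  simp only [shift]
  simp only [← slab, ← row]
  rw [Finset.prod_comm (s := Finset.range c)]
  refine Finset.prod_congr rfl fun i _ => ?_
  rw [Finset.prod_comm (s := Finset.range c)]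
  refine Finset.prod_congr rfl fun j _ => Finset.prod_congr rfl fun k _ => ?_
  push_cast
  congr 1 <;> ring

namespace YoungDiagram

theorem ext_rowLen {μ ν : YoungDiagram} (h : ∀ i, μ.rowLen i = ν.rowLen i) : μ = ν := by
  ext ⟨i, j⟩
  rw [mem_cells, mem_cells, mem_iff_lt_rowLen, mem_iff_lt_rowLen, h]

theorem rowLen_eq_zero_iff {μ : YoungDiagram} {i : ℕ} : μ.rowLen i = 0 ↔ μ.colLen 0 ≤ i := by
  rw [← not_lt, ← mem_iff_lt_colLen, mem_iff_lt_rowLen, Nat.pos_iff_ne_zero, not_not]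

/-- The Young diagram with row lengths `f`, where `f` is antitone and vanishes from `c` on. -/
def ofRowLen (f : ℕ → ℕ) (hf : Antitone f) (c : ℕ) : YoungDiagram where
  cells := {p ∈ Finset.range c ×ˢ Finset.range (f 0) | p.2 < f p.1}
  isLowerSet := by
    rintro ⟨i, j⟩ ⟨i', j'⟩ ⟨hi, hj⟩ h
    have := hf hi
    simp only [Finset.coe_filter, Finset.mem_product, Finset.mem_range, Set.mem_ofPred_eq] at *
    omega

theorem rowLen_ofRowLen' {f : ℕ → ℕ} (hf : Antitone f) {c : ℕ} (hc : ∀ i, c ≤ i → f i = 0)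
    (i : ℕ) : (ofRowLen f hf c).rowLen i = f i := by
  refine eq_of_forall_lt_iff fun j => ?_
  rw [← mem_iff_lt_rowLen, ← mem_cells]
  simp only [ofRowLen, Finset.mem_filter, Finset.mem_product, Finset.mem_range]
  have := hf (Nat.zero_le i)
  have := hc i
  omega

end YoungDiagram

theorem schur_one_transpose (a : ℕ) {c : ℕ} {μ : YoungDiagram} (hμ : μ.colLen 0 ≤ c) :
    schur (fun _ : Fin a => (1 : ℝ)) μ.transpose =
      (Matrix.of fun i j : Fin c => intChoose a ((μ.rowLen i : ℤ) - i + j)).det := by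
  obtain ⟨d, rfl⟩ := Nat.exists_eq_add_of_le hμ
  have hblock : (Matrix.of fun i j : Fin (μ.colLen 0 + d) =>
        intChoose a ((μ.rowLen i : ℤ) - i + j)).submatrix finSumFinEquiv finSumFinEquiv =
      Matrix.fromBlocks
        (.of fun i j : Fin (μ.colLen 0) => intChoose a ((μ.rowLen i : ℤ) - i + j))
        (.of fun (i : Fin (μ.colLen 0)) (j : Fin d) =>
          intChoose a ((μ.rowLen i : ℤ) - i + (μ.colLen 0 + j : ℕ)))
        0 (.of fun i j : Fin d => intChoose a ((j : ℤ) - i)) := by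
    have hzero (i : ℕ) : μ.rowLen (μ.colLen 0 + i) = 0 :=
      YoungDiagram.rowLen_eq_zero_iff.mpr (Nat.le_add_right _ _)
    ext (i | i) (j | j)
    · simp
    · simp
    · simp only [Matrix.submatrix_apply, Matrix.of_apply, finSumFinEquiv_apply_left,
        finSumFinEquiv_apply_right, Matrix.fromBlocks_apply₂₁, Matrix.zero_apply, Fin.val_castAdd,
        Fin.val_natAdd, hzero]
      exact intChoose.of_neg (by omega)
    · simp only [Matrix.submatrix_apply, Matrix.of_apply,
        finSumFinEquiv_apply_right, Matrix.fromBlocks_apply₂₂,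
        Fin.val_natAdd, hzero]
      congr 1
      push_cast
      ring
  have hunit : (Matrix.of fun i j : Fin d => intChoose a ((j : ℤ) - i)).det = 1 := by
    rw [Matrix.det_of_isUpperTriangular]
    · refine Finset.prod_eq_one fun i _ => ?_
      have := intChoose.natCast a 0
      simpa using this
    · intro i j hij
      have : j < i := hij
      exact intChoose.of_neg (by omega)
  rw [← Matrix.det_submatrix_equiv_self finSumFinEquiv, hblock, Matrix.det_fromBlocks_zero₂₁,
    hunit, mul_one]
  have hlen : μ.transpose.rowLen 0 = μ.colLen 0 := μ.rowLen_transpose 0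
  rw [← Matrix.det_submatrix_equiv_self (finCongr hlen), schur]
  congr 1
  ext i j
  simp [esymmInt_one, YoungDiagram.colLen_transpose]

theorem schur_one_transpose_eq_zero {a c : ℕ} (hc : 1 ≤ c) {μ : YoungDiagram}
    (hμ : μ.colLen 0 ≤ c) (ha : a < μ.rowLen 0) :
    schur (fun _ : Fin a => (1 : ℝ)) μ.transpose = 0 := by
  rw [schur_one_transpose a hμ]
  refine Matrix.det_eq_zero_of_row_eq_zero ⟨0, hc⟩ fun j => ?_
  rw [Matrix.of_apply]
  exact intChoose.of_lt (by simp only [Nat.cast_zero]; omega)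

section PartitionsAsSubsets

variable {c n : ℕ}

/-- The row lengths of the partition whose shifted parts are the values of `s`. -/
def shiftedRowLen (s : Fin c ↪o Fin n) (i : ℕ) : ℕ :=
  if h : i < c then (s (Fin.rev ⟨i, h⟩) : ℕ) - (c - (i + 1)) else 0

theorem shiftedRowLen_antitone (s : Fin c ↪o Fin n) : Antitone (shiftedRowLen s) := by
  refine antitone_nat_of_succ_le fun i => ?_
  unfold shiftedRowLen
  split_ifs with h₁ h₂
  · have : s (Fin.rev ⟨i + 1, h₁⟩) < s (Fin.rev ⟨i, h₂⟩) :=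
      s.strictMono (Fin.rev_lt_rev.mpr (by simp))
    omega
  all_goals omega

/-- The partition with at most `c` parts whose shifted parts are the values of `s`. -/
def youngOfOrderEmb (s : Fin c ↪o Fin n) : YoungDiagram :=
  .ofRowLen (shiftedRowLen s) (shiftedRowLen_antitone s) c

theorem rowLen_youngOfOrderEmb (s : Fin c ↪o Fin n) (i : ℕ) :
    (youngOfOrderEmb s).rowLen i = shiftedRowLen s i :=
  YoungDiagram.rowLen_ofRowLen' _ (fun i hi => dif_neg (by omega)) i

theorem colLen_youngOfOrderEmb_le (s : Fin c ↪o Fin n) : (youngOfOrderEmb s).colLen 0 ≤ c := by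
  rw [← YoungDiagram.rowLen_eq_zero_iff, rowLen_youngOfOrderEmb]
  exact dif_neg (by omega)

theorem OrderEmbedding.val_le_val_fin (s : Fin c ↪o Fin n) (i : Fin c) : (i : ℕ) ≤ s i := by
  obtain ⟨i, hi⟩ := i
  induction i with
  | zero => simp
  | succ i ih =>
    have h₁ : s ⟨i, by omega⟩ < s ⟨i + 1, hi⟩ := s.strictMono (by simp)
    have h₂ := ih (by omega)
    simp only [Fin.lt_def] at h₁ h₂ ⊢
    omega

theorem rowLen_youngOfOrderEmb_rev (s : Fin c ↪o Fin n) (i : Fin c) :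
    (youngOfOrderEmb s).rowLen (Fin.rev i) + i = s i := by
  have := OrderEmbedding.val_le_val_fin s i
  have hrev : (⟨Fin.rev i, (Fin.rev i).2⟩ : Fin c).rev = i := Fin.rev_rev i
  rw [rowLen_youngOfOrderEmb, shiftedRowLen, dif_pos (Fin.rev i).2, hrev, Fin.val_rev]
  omega

theorem youngOfOrderEmb_injective :
    Function.Injective (youngOfOrderEmb : (Fin c ↪o Fin n) → YoungDiagram) := by
  intro s t h
  ext i
  rw [← rowLen_youngOfOrderEmb_rev, h, rowLen_youngOfOrderEmb_rev]

theorem exists_youngOfOrderEmb_eq {a : ℕ} {μ : YoungDiagram} (hμ : μ.colLen 0 ≤ c)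
    (ha : μ.rowLen 0 ≤ a) : ∃ s : Fin c ↪o Fin (a + c), youngOfOrderEmb s = μ := by
  have hlt (i : Fin c) : μ.rowLen (Fin.rev i) + i < a + c := by
    have := μ.rowLen_anti 0 (Fin.rev i) (Nat.zero_le _)
    omega
  refine ⟨OrderEmbedding.ofStrictMono (fun i => ⟨μ.rowLen (Fin.rev i) + i, hlt i⟩) ?_, ?_⟩
  · intro i j hij
    have := μ.rowLen_anti (Fin.rev j) (Fin.rev i) (by simp only [Fin.val_rev]; omega)
    simp only [Fin.lt_def] at hij ⊢
    omega
  · refine YoungDiagram.ext_rowLen fun i => ?_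
    rw [rowLen_youngOfOrderEmb, shiftedRowLen]
    split_ifs with h
    · simp only [OrderEmbedding.coe_ofStrictMono, Fin.val_rev]
      have : c - (c - (i + 1) + 1) = i := by omega
      rw [this, Nat.add_sub_cancel]
    · exact (YoungDiagram.rowLen_eq_zero_iff.mpr (by omega)).symm

theorem schur_one_transpose_youngOfOrderEmb (a : ℕ) (s : Fin c ↪o Fin n) :
    schur (fun _ : Fin a => (1 : ℝ)) (youngOfOrderEmb s).transpose =
      (Matrix.of fun i j : Fin c => intChoose a ((s i : ℤ) - j)).det := by
  rw [schur_one_transpose a (colLen_youngOfOrderEmb_le s),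
    ← Matrix.det_submatrix_equiv_self Fin.revPerm]
  congr 1
  ext i j
  have := rowLen_youngOfOrderEmb_rev s i
  simp only [Matrix.submatrix_apply, Matrix.of_apply, Fin.revPerm_apply]
  congr 1
  rw [← this]
  simp only [Fin.val_rev]
  omega

end PartitionsAsSubsets

/-- MacMahon's box formula in Schur function form:
`∑_{μ : ℓ(μ) ≤ c} s_{μ'}(1^a) s_{μ'}(1^b) = ∏_{i,j,k} (i+j+k-1)/(i+j+k-2)`. -/
theorem macmahon_schur (a b c : ℕ) (ha : 1 ≤ a) (hb : 1 ≤ b) (hc : 1 ≤ c) :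
    (∑' μ : {μ : YoungDiagram // μ.colLen 0 ≤ c},
        schur (fun _ : Fin a => (1 : ℝ)) (μ : YoungDiagram).transpose *
          schur (fun _ : Fin b => (1 : ℝ)) (μ : YoungDiagram).transpose) =
      ∏ i ∈ Finset.Icc 1 a, ∏ j ∈ Finset.Icc 1 b, ∏ k ∈ Finset.Icc 1 c,
        (((i : ℝ) + j + k - 1) / ((i : ℝ) + j + k - 2)) := by
  let Φ (s : Fin c ↪o Fin (a + c)) : {μ : YoungDiagram // μ.colLen 0 ≤ c} :=
    ⟨youngOfOrderEmb s, colLen_youngOfOrderEmb_le s⟩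
  have hΦ : Function.Injective Φ := fun s t h =>
    youngOfOrderEmb_injective (congrArg Subtype.val h)
  rw [← hΦ.tsum_eq, tsum_fintype]
  · simp only [Φ, schur_one_transpose_youngOfOrderEmb]
    let A : Matrix (Fin c) (Fin (a + c)) ℝ := .of fun j m => intChoose a ((m : ℤ) - j)
    let B : Matrix (Fin (a + c)) (Fin c) ℝ := .of fun m k => intChoose b ((m : ℤ) - k)
    have hAB : A * B =
        (Matrix.of fun i j : Fin c => intChoose (a + b) ((b : ℤ) + i - j)).transpose := by
      ext j k
      simp only [Matrix.mul_apply, Matrix.transpose_apply, Matrix.of_apply, A, B]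
      rw [Fin.sum_univ_eq_sum_range
        (fun m => intChoose a ((m : ℤ) - j) * intChoose b ((m : ℤ) - k)) (a + c),
        ← intChoose.sum_shift_mul a b j ((b : ℤ) + k) (N := a + c) (by omega)]
      refine Finset.sum_congr rfl fun m _ => ?_
      rw [← intChoose.symm b (m - k)]
      congr 2
      ring
    rw [prod_box_ratio, ← det_intChoose, ← Matrix.det_transpose, ← hAB,
      Matrix.det_mul_eq_sum_orderEmbedding]
    refine Finset.sum_congr rfl fun s _ => ?_
    rw [← Matrix.det_transpose (A.submatrix id s)]
    rfl
  · intro μ hμ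
    have hle : (μ : YoungDiagram).rowLen 0 ≤ a := by
      by_contra! h
      exact hμ (by simp [schur_one_transpose_eq_zero hc μ.2 h])
    obtain ⟨s, hs⟩ := exists_youngOfOrderEmb_eq μ.2 hle
    exact ⟨s, Subtype.ext hs⟩
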